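/- arXiv:2012.09814 — 8 statements merged into one kernel-verified Lean document; each statement's English description precedes it below -/
import Mathlib

section
/- Let G be a finite simple graph on a vertex type V in which every vertex has degree at least 4, and let k ≥ 5 be a natural number. Define the graph G' on the vertex type V ⊕ E, where E is the type of edges of G, by: inl u and inl v are adjacent iff u ≠ v; inr e and inr f are adjacent iff e ≠ f; inl u and inr e are adjacent iff u is an endpoint of the edge e. Define the graph H on the vertex type (Fin k) ⊕ P, where P is the type of unordered pairs of distinct elements of Fin k, by: inl i and inl j are adjacent iff i ≠ j; inr p and inr q are adjacent iff p ≠ q; inl i and inr p are adjacent iff i is a member of the pair p. Then G has a clique on k vertices if and only if there exists a graph embedding of H into G' (i.e., an injective map preserving adjacency and non-adjacency, so that H is isomorphic to an induced subgraph of G'). -/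
/-- Among at least four indices, three given ones can be avoided. -/
lemma Fin.exists_ne_ne_ne {k : ℕ} (hk : 4 ≤ k) (a b c : Fin k) :
    ∃ d : Fin k, d ≠ a ∧ d ≠ b ∧ d ≠ c := by
  have hcard : ({a, b, c} : Finset (Fin k)).card < (Finset.univ : Finset (Fin k)).card := by
    rw [Finset.card_univ, Fintype.card_fin]
    exact lt_of_le_of_lt Finset.card_le_three (by omega)
  obtain ⟨d, -, hd⟩ := Finset.exists_mem_notMem_of_card_lt_card hcard
  exact ⟨d, by simpa using hd⟩

/-- An unordered pair has at most two distinct members. -/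
lemma Sym2.not_three_mem {α : Type*} {e : Sym2 α} {a b c : α} (hab : a ≠ b) (hac : a ≠ c)
    (hbc : b ≠ c) (ha : a ∈ e) (hb : b ∈ e) : c ∉ e := by
  rw [(Sym2.mem_and_mem_iff hab).1 ⟨ha, hb⟩, Sym2.mem_iff]
  tauto


theorem stmt_0 {V : Type*} [Fintype V] [DecidableEq V] (G : SimpleGraph V)
    [DecidableRel G.Adj]
    (hdeg : ∀ v : V, 4 ≤ G.degree v) (k : ℕ) (hk : 5 ≤ k)
    (G' : SimpleGraph (V ⊕ G.edgeSet))
    (hG'₁ : ∀ u v : V, G'.Adj (Sum.inl u) (Sum.inl v) ↔ u ≠ v)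
    (hG'₂ : ∀ e f : G.edgeSet, G'.Adj (Sum.inr e) (Sum.inr f) ↔ e ≠ f)
    (hG'₃ : ∀ (u : V) (e : G.edgeSet), G'.Adj (Sum.inl u) (Sum.inr e) ↔ u ∈ (e : Sym2 V))
    (hG'₄ : ∀ (u : V) (e : G.edgeSet), G'.Adj (Sum.inr e) (Sum.inl u) ↔ u ∈ (e : Sym2 V))
    (H : SimpleGraph (Fin k ⊕ {p : Sym2 (Fin k) // ¬ p.IsDiag}))
    (hH₁ : ∀ i j : Fin k, H.Adj (Sum.inl i) (Sum.inl j) ↔ i ≠ j)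
    (hH₂ : ∀ p q : {p : Sym2 (Fin k) // ¬ p.IsDiag},
      H.Adj (Sum.inr p) (Sum.inr q) ↔ p ≠ q)
    (hH₃ : ∀ (i : Fin k) (p : {p : Sym2 (Fin k) // ¬ p.IsDiag}),
      H.Adj (Sum.inl i) (Sum.inr p) ↔ i ∈ (p : Sym2 (Fin k)))
    (hH₄ : ∀ (i : Fin k) (p : {p : Sym2 (Fin k) // ¬ p.IsDiag}),
      H.Adj (Sum.inr p) (Sum.inl i) ↔ i ∈ (p : Sym2 (Fin k))) :
    (∃ s : Finset V, s.card = k ∧ G.IsClique (s : Set V)) ↔ Nonempty (H ↪g G') := by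
  constructor
  · rintro ⟨s, hs, hclique⟩
    let g : Fin k ↪ V := (s.equivFinOfCardEq hs).symm.toEmbedding.trans
      (Function.Embedding.subtype _)
    have hgs (i : Fin k) : g i ∈ (s : Set V) := ((s.equivFinOfCardEq hs).symm i).2
    have hedge (p : Sym2 (Fin k)) (hp : ¬ p.IsDiag) : p.map g ∈ G.edgeSet := by
      induction p with
      | _ i j => exact hclique (hgs i) (hgs j) fun h => hp (g.injective h)
    let φ (p : {p : Sym2 (Fin k) // ¬ p.IsDiag}) : G.edgeSet := ⟨p.1.map g, hedge p.1 p.2⟩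
    have hφ : Function.Injective φ := fun p q h =>
      Subtype.ext (Sym2.map.injective g.injective (congrArg Subtype.val h))
    have hmem (i : Fin k) (p : {p : Sym2 (Fin k) // ¬ p.IsDiag}) :
        g i ∈ (φ p : Sym2 V) ↔ i ∈ (p : Sym2 (Fin k)) := by
      simp [φ, Sym2.mem_map]
    refine ⟨⟨⟨Sum.map g φ, g.injective.sumMap hφ⟩, ?_⟩⟩
    rintro (i | p) (j | q)
    · simp [hG'₁, hH₁]
    · simp [hG'₃, hH₃, hmem]
    · simp [hG'₄, hH₄, hmem]
    · simp [hG'₂, hH₂, hφ.ne_iff]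
  · rintro ⟨f⟩
    -- Each side of `G'` is a clique, so non-adjacent vertices lie on opposite sides.
    have hside (x y : V ⊕ G.edgeSet) (hne : x ≠ y) (hadj : ¬ G'.Adj x y) :
        x.isLeft = !y.isLeft := by
      rcases x with u | d <;> rcases y with v | e
      · exact absurd ((hG'₁ u v).2 fun h => hne (h ▸ rfl)) hadj
      · rfl
      · rfl
      · exact absurd ((hG'₂ d e).2 fun h => hne (h ▸ rfl)) hadj
    have hopp (i : Fin k) (p : {p : Sym2 (Fin k) // ¬ p.IsDiag})
        (hip : i ∉ (p : Sym2 (Fin k))) : (f (.inl i)).isLeft = !(f (.inr p)).isLeft :=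
      hside _ _ (f.injective.ne Sum.inl_ne_inr) (by rwa [f.map_adj_iff, hH₃])
    have hsame (i j : Fin k) : (f (.inl i)).isLeft = (f (.inl j)).isLeft := by
      obtain ⟨a, hai, haj, -⟩ := Fin.exists_ne_ne_ne (by omega) i j j
      obtain ⟨b, hbi, hbj, hba⟩ := Fin.exists_ne_ne_ne (by omega) i j a
      rw [hopp i ⟨s(a, b), by simpa using hba.symm⟩ (by simp [hai.symm, hbi.symm]),
        hopp j ⟨s(a, b), by simpa using hba.symm⟩ (by simp [haj.symm, hbj.symm])]
    have hpair (i : Fin k) (p : {p : Sym2 (Fin k) // ¬ p.IsDiag}) :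
        (f (.inr p)).isLeft = !(f (.inl i)).isLeft := by
      obtain ⟨⟨a, b⟩, hp⟩ := p
      obtain ⟨c, hca, hcb, -⟩ := Fin.exists_ne_ne_ne (by omega) a b b
      rw [hsame i c, hopp c ⟨s(a, b), hp⟩ (by simp [hca, hcb]), Bool.not_not]
    let i₀ : Fin k := ⟨0, by omega⟩
    cases h₀ : (f (.inl i₀)).isLeft with
    | true =>
      have hvert (i : Fin k) : ∃ v, f (.inl i) = .inl v :=
        Sum.isLeft_iff.1 ((hsame i i₀).trans h₀)
      choose g hg using hvert
      have hgi : Function.Injective g := fun i j h =>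
        Sum.inl_injective (f.injective (by rw [hg, hg, h]))
      refine ⟨Finset.univ.map ⟨g, hgi⟩, by simp, ?_⟩
      rintro _ hu _ hv huv
      simp only [Finset.coe_map, Finset.coe_univ, Set.image_univ, Set.mem_range,
        Function.Embedding.coeFn_mk] at hu hv
      obtain ⟨i, rfl⟩ := hu
      obtain ⟨j, rfl⟩ := hv
      have hij : i ≠ j := fun h => huv (h ▸ rfl)
      let p : {p : Sym2 (Fin k) // ¬ p.IsDiag} := ⟨s(i, j), by simpa using hij⟩
      obtain ⟨e, he⟩ : ∃ e, f (.inr p) = .inr e := by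
        rw [← Sum.isRight_iff, ← Sum.not_isLeft, hpair i₀, h₀]
        simp
      have hinc (l : Fin k) (hl : l ∈ s(i, j)) : g l ∈ (e : Sym2 V) := by
        rw [← hG'₃, ← hg, ← he, f.map_adj_iff, hH₃]
        exact hl
      rw [← SimpleGraph.mem_edgeSet, ← (Sym2.mem_and_mem_iff huv).1
        ⟨hinc i (Sym2.mem_mk_left i j), hinc j (Sym2.mem_mk_right i j)⟩]
      exact e.2
    | false =>
      obtain ⟨e, he⟩ : ∃ e, f (.inl i₀) = .inr e := by
        rw [← Sum.isRight_iff, ← Sum.not_isLeft, h₀]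
        simp
      -- The pairs containing `i₀` become distinct endpoints of the edge `e`.
      have hend (j : Fin k) (hj : j ≠ i₀) : ∃ v, v ∈ (e : Sym2 V) ∧
          f (.inr ⟨s(i₀, j), by simpa using hj.symm⟩) = .inl v := by
        obtain ⟨v, hv⟩ := Sum.isLeft_iff.1
          ((hpair i₀ ⟨s(i₀, j), by simpa using hj.symm⟩).trans (by rw [h₀, Bool.not_false]))
        refine ⟨v, ?_, hv⟩
        rw [← hG'₃, ← hv, ← he, f.map_adj_iff, hH₄]
        exact Sym2.mem_mk_left _ _
      choose w hwe hw using hend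
      have hne (a b : Fin k) (ha : a ≠ i₀) (hb : b ≠ i₀) (hab : a ≠ b) :
          w a ha ≠ w b hb := by
        intro h
        have := f.injective ((hw a ha).trans ((congrArg Sum.inl h).trans (hw b hb).symm))
        simp_all
      obtain ⟨a, ha, -⟩ := Fin.exists_ne_ne_ne (by omega) i₀ i₀ i₀
      obtain ⟨b, hb, hba, -⟩ := Fin.exists_ne_ne_ne (by omega) i₀ a a
      obtain ⟨c, hc, hca, hcb⟩ := Fin.exists_ne_ne_ne (by omega) i₀ a b
      exact absurd (hwe c hc) (Sym2.not_three_mem (hne a b ha hb hba.symm)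
        (hne a c ha hc hca.symm) (hne b c hb hc hcb.symm) (hwe a ha)
        (hwe b hb))
end

section
/- Let G be a finite simple AT-free graph, let t ≥ 3, and let x : Fin t → V be an injective map whose images form a cycle in cyclic order, i.e., x(i) is adjacent to x(i+1) for all i taken modulo t. Then there exist indices i and j with 0 ≤ i < i + j ≤ t - 1 and 2 ≤ j ≤ 4 such that x(i) and x(i+j) are adjacent in G. -/
/-- A graph has an asteroidal triple if there are three pairwise non-adjacent vertices
such that between any two of them there is a walk none of whose vertices lies in the
closed neighbourhood of the third. -/
def HasAsteroidalTriple {V : Type*} (G : SimpleGraph V) : Prop :=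
  ∃ x y z : V, x ≠ y ∧ x ≠ z ∧ y ≠ z ∧ ¬G.Adj x y ∧ ¬G.Adj x z ∧ ¬G.Adj y z ∧
    (∃ w : G.Walk x y, ∀ v ∈ w.support, v ≠ z ∧ ¬G.Adj z v) ∧
    (∃ w : G.Walk x z, ∀ v ∈ w.support, v ≠ y ∧ ¬G.Adj y v) ∧
    (∃ w : G.Walk y z, ∀ v ∈ w.support, v ≠ x ∧ ¬G.Adj x v)

/-- A graph is AT-free if it has no asteroidal triple. -/
def ATFree {V : Type*} (G : SimpleGraph V) : Prop := ¬ HasAsteroidalTriple G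

/-- A sequence of consecutively adjacent vertices yields a walk through exactly these vertices. -/
theorem exists_walk_of_adj_succ {V : Type*} {G : SimpleGraph V} {y : ℕ → V} {m n : ℕ}
    (hmn : m ≤ n) (h : ∀ k, m ≤ k → k < n → G.Adj (y k) (y (k + 1))) :
    ∃ w : G.Walk (y m) (y n), ∀ v ∈ w.support, ∃ k, m ≤ k ∧ k ≤ n ∧ v = y k := by
  induction n, hmn using Nat.le_induction with
  | base => exact ⟨.nil, fun v hv => ⟨m, le_rfl, le_rfl, by simpa using hv⟩⟩
  | succ n hmn ih =>
    obtain ⟨w, hw⟩ := ih fun k h₁ h₂ => h k h₁ (by omega)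
    refine ⟨w.concat (h n hmn (by omega)), fun v hv => ?_⟩
    rw [SimpleGraph.Walk.support_concat, List.mem_append,
      List.mem_singleton] at hv
    rcases hv with hv | rfl
    · obtain ⟨k, h₁, h₂, rfl⟩ := hw v hv
      exact ⟨k, h₁, by omega, rfl⟩
    · exact ⟨n + 1, by omega, le_rfl, rfl⟩

/-- An induced cycle on at least six vertices contains an asteroidal triple. -/
theorem hasAsteroidalTriple_of_induced_cycle {V : Type*} {G : SimpleGraph V} {y : ℕ → V}
    {a b : ℕ} (hab : a + 5 ≤ b)
    (hne : ∀ i j, a ≤ i → i < j → j ≤ b → y i ≠ y j)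
    (hadj : ∀ i, a ≤ i → i < b → G.Adj (y i) (y (i + 1)))
    (hclose : G.Adj (y a) (y b))
    (hchord : ∀ i j, a ≤ i → i + 2 ≤ j → j ≤ b → j - i < b - a → ¬G.Adj (y i) (y j)) :
    HasAsteroidalTriple G := by
  have away : ∀ i k, a ≤ i → i ≤ b → a ≤ k → k ≤ b → i + 2 ≤ k ∨ k + 2 ≤ i →
      k - i < b - a → i - k < b - a → y k ≠ y i ∧ ¬G.Adj (y i) (y k) := by
    intro i k hi hib hk hkb h h₁ h₂
    rcases h with h | h
    · exact ⟨(hne i k hi (by omega) hkb).symm, hchord i k hi h hkb h₁⟩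
    · exact ⟨hne k i hk (by omega) hib, fun hh => hchord k i hk h hib h₂ hh.symm⟩
  refine ⟨y a, y (a + 2), y (a + 4), hne _ _ (by omega) (by omega) (by omega),
    hne _ _ (by omega) (by omega) (by omega), hne _ _ (by omega) (by omega) (by omega),
    hchord _ _ (by omega) (by omega) (by omega) (by omega),
    hchord _ _ (by omega) (by omega) (by omega) (by omega),
    hchord _ _ (by omega) (by omega) (by omega) (by omega), ?_, ?_, ?_⟩
  · obtain ⟨w, hw⟩ := exists_walk_of_adj_succ (G := G) (y := y) (m := a) (n := a + 2) (by omega)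
      fun k h₁ h₂ => hadj k h₁ (by omega)
    refine ⟨w, fun v hv => ?_⟩
    obtain ⟨k, h₁, h₂, rfl⟩ := hw v hv
    exact away _ _ (by omega) (by omega) (by omega) (by omega) (by omega) (by omega) (by omega)
  · obtain ⟨w, hw⟩ := exists_walk_of_adj_succ (G := G) (y := y) (m := a + 4) (n := b) (by omega)
      fun k h₁ h₂ => hadj k (by omega) h₂
    refine ⟨.cons hclose w.reverse, fun v hv => ?_⟩
    rw [SimpleGraph.Walk.support_cons, List.mem_cons, SimpleGraph.Walk.support_reverse,
      List.mem_reverse] at hv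
    rcases hv with rfl | hv
    · exact away _ _ (by omega) (by omega) (by omega) (by omega) (by omega) (by omega) (by omega)
    · obtain ⟨k, h₁, h₂, rfl⟩ := hw v hv
      exact away _ _ (by omega) (by omega) (by omega) (by omega) (by omega) (by omega) (by omega)
  · obtain ⟨w, hw⟩ := exists_walk_of_adj_succ (G := G) (y := y) (m := a + 2) (n := a + 4)
      (by omega) fun k h₁ h₂ => hadj k (by omega) (by omega)
    refine ⟨w, fun v hv => ?_⟩
    obtain ⟨k, h₁, h₂, rfl⟩ := hw v hv
    exact away _ _ (by omega) (by omega) (by omega) (by omega) (by omega) (by omega) (by omega)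

theorem stmt_1 {V : Type*} [Fintype V] (G : SimpleGraph V) (hAT : ATFree G)
    (t : ℕ) (ht : 3 ≤ t) (x : Fin t → V) (hinj : Function.Injective x)
    (hcyc : ∀ i : Fin t, G.Adj (x i) (x ⟨((i : ℕ) + 1) % t, Nat.mod_lt _ (by omega)⟩)) :
    ∃ i j : Fin t, (i : ℕ) + 2 ≤ (j : ℕ) ∧ (j : ℕ) ≤ (i : ℕ) + 4 ∧ G.Adj (x i) (x j) := by
  by_contra! hno
  have ht₀ : 0 < t := by omega
  let y : ℕ → V := fun n => x ⟨n % t, Nat.mod_lt _ ht₀⟩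
  have hy : ∀ n (h : n < t), y n = x ⟨n, h⟩ := fun n h => by simp [y, Nat.mod_eq_of_lt h]
  have hlast : G.Adj (y 0) (y (t - 1)) := by
    have h := (hcyc ⟨t - 1, by omega⟩).symm
    rw [hy 0 ht₀, hy (t - 1) (by omega)]
    simpa [Nat.sub_add_cancel (by omega : 1 ≤ t)] using h
  classical
  have hex : ∃ d, ∃ a, 2 ≤ d ∧ a + d < t ∧ G.Adj (y a) (y (a + d)) :=
    ⟨t - 1, 0, by omega, by omega, by simpa using hlast⟩
  obtain ⟨a, hd, hat, hadj⟩ := Nat.find_spec hex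
  have hmin := fun d => Nat.find_min (m := d) hex
  generalize Nat.find hex = d at *
  have hd₅ : 5 ≤ d := by
    by_contra! h
    rw [hy a (by omega), hy _ hat] at hadj
    exact hno ⟨a, by omega⟩ ⟨a + d, hat⟩ (by simpa using hd) (by simp; omega) hadj
  refine hAT (hasAsteroidalTriple_of_induced_cycle (y := y) (a := a) (b := a + d) (by omega)
    ?_ ?_ hadj ?_)
  · intro i j _ hij hj h
    rw [hy i (by omega), hy j (by omega)] at h
    have := congrArg Fin.val (hinj h)
    simp only at this
    omega
  · intro i _ hi
    rw [hy i (by omega), hy (i + 1) (by omega)]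
    simpa [Nat.mod_eq_of_lt (by omega : i + 1 < t)] using hcyc ⟨i, by omega⟩
  · intro i j _ hij hj hlt h
    exact hmin (j - i) (by omega) ⟨i, by omega, by omega, by
      rwa [Nat.add_sub_cancel' (by omega : i ≤ j)]⟩
end

section
/- Assume the terminal-pair setup with auxiliary graph H. If H is AT-free, then G is triangle-free, i.e., G contains no three pairwise adjacent vertices. -/
theorem stmt_3 {V : Type*} [Fintype V] (G : SimpleGraph V) (k : ℕ)
    (s t : Fin k → V)
    (hst : ∀ i, s i ≠ t i ∧ ¬ G.Adj (s i) (t i))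
    (hdist : ∀ i j : Fin k, i ≠ j →
      Sym2.mk (s i, t i) ≠ Sym2.mk (s j, t j))
    (hcover : ∀ v : V, ∃ i : Fin k, v = s i ∨ v = t i)
    (H : SimpleGraph (V ⊕ Fin k))
    (hH₁ : ∀ u v : V, H.Adj (Sum.inl u) (Sum.inl v) ↔ G.Adj u v)
    (hH₂ : ∀ (u : V) (i : Fin k), H.Adj (Sum.inl u) (Sum.inr i) ↔ (u = s i ∨ u = t i))
    (hH₃ : ∀ (u : V) (i : Fin k), H.Adj (Sum.inr i) (Sum.inl u) ↔ (u = s i ∨ u = t i))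
    (hH₄ : ∀ i j : Fin k, ¬ H.Adj (Sum.inr i) (Sum.inr j))
    (hAT : ATFree H) :
    ¬ ∃ x y z : V, G.Adj x y ∧ G.Adj y z ∧ G.Adj x z := by
  rintro ⟨x, y, z, hxy, hyz, hxz⟩
  have not_both : ∀ (a b : V) (i : Fin k), G.Adj a b →
      (a = s i ∨ a = t i) → ¬ (b = s i ∨ b = t i) := by
    rintro a b i hab (rfl | rfl) (rfl | rfl)
    · exact G.irrefl hab
    · exact (hst i).2 hab
    · exact (hst i).2 hab.symm
    · exact G.irrefl hab
  have avoiding_walk : ∀ (a b c : V) (i j l : Fin k), G.Adj a b → G.Adj a c → G.Adj b c →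
      (a = s i ∨ a = t i) → (b = s j ∨ b = t j) → (c = s l ∨ c = t l) →
      ∃ w : H.Walk (Sum.inr i) (Sum.inr j),
        ∀ v ∈ w.support, v ≠ Sum.inr l ∧ ¬ H.Adj (Sum.inr l) v := by
    intro a b c i j l hab hac hbc ha hb hc
    refine ⟨.cons ((hH₃ a i).2 ha) (.cons ((hH₁ a b).2 hab)
      (.cons ((hH₂ b j).2 hb) .nil)), ?_⟩
    intro v hv
    simp only [SimpleGraph.Walk.support_cons, SimpleGraph.Walk.support_nil,
      List.mem_cons, List.not_mem_nil, or_false] at hv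
    rcases hv with rfl | rfl | rfl | rfl
    · refine ⟨fun h => ?_, hH₄ _ _⟩
      cases h
      exact not_both a c _ hac ha hc
    · exact ⟨Sum.inl_ne_inr, fun h => not_both c a l hac.symm hc ((hH₃ a l).1 h)⟩
    · exact ⟨Sum.inl_ne_inr, fun h => not_both c b l hbc.symm hc ((hH₃ b l).1 h)⟩
    · refine ⟨fun h => ?_, hH₄ _ _⟩
      cases h
      exact not_both b c _ hbc hb hc
  have path_ne : ∀ (a b : V) (i j : Fin k), G.Adj a b →
      (a = s i ∨ a = t i) → (b = s j ∨ b = t j) →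
      (Sum.inr i : V ⊕ Fin k) ≠ Sum.inr j := by
    intro a b i j hab ha hb h
    cases h
    exact not_both a b _ hab ha hb
  obtain ⟨i, hi⟩ := hcover x
  obtain ⟨j, hj⟩ := hcover y
  obtain ⟨l, hl⟩ := hcover z
  exact hAT ⟨Sum.inr i, Sum.inr j, Sum.inr l,
    path_ne x y i j hxy hi hj, path_ne x z i l hxz hi hl, path_ne y z j l hyz hj hl,
    hH₄ i j, hH₄ i l, hH₄ j l,
    avoiding_walk x y z i j l hxy hxz hyz hi hj hl,
    avoiding_walk x z y i l j hxz hxy hyz.symm hi hl hj,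
    avoiding_walk y z x j l i hyz hxy.symm hxz.symm hj hl hi⟩
end

section
/- Assume the terminal-pair setup with auxiliary graph H, and assume that H is connected and AT-free and that k ≥ 1. Then H has a dominating pair both of whose members are terminal vertices: there exist vertices x and y of V such that the vertex set of every path in H from inl x to inl y dominates H. -/
/-- `(x, y)` is a dominating pair of `G` if the vertex set of every path from `x` to `y`
dominates `G`: every vertex lies on the path or is adjacent to a vertex of the path. -/
def IsDominatingPair {V : Type*} (G : SimpleGraph V) (x y : V) : Prop :=
  ∀ (p : G.Walk x y), p.IsPath →
    ∀ w : V, w ∈ p.support ∨ ∃ u ∈ p.support, G.Adj u w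

/-- Some walk from `x` to `y` has no vertex in the closed neighbourhood of `z`. -/
def Misses {V : Type*} (G : SimpleGraph V) (z x y : V) : Prop :=
  ∃ w : G.Walk x y, ∀ v ∈ w.support, v ≠ z ∧ ¬G.Adj z v

/-- No two vertices `u`, `v` are unrelated with respect to `x`, that is, such that each of them
misses a walk from `x` to the other. -/
def Admissible {V : Type*} (G : SimpleGraph V) (x : V) : Prop :=
  ∀ u v : V, Misses G u x v → ¬Misses G v x u

namespace Misses

variable {V : Type*} {G : SimpleGraph V} {x y z u v : V}

theorem refl (h : x ≠ z) (h' : ¬G.Adj z x) : Misses G z x x :=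
  ⟨.nil, by simp [h, h']⟩

theorem symm (h : Misses G z x y) : Misses G z y x := by
  obtain ⟨w, hw⟩ := h
  exact ⟨w.reverse, by simpa using hw⟩

theorem trans (h : Misses G z x y) (h' : Misses G z y u) : Misses G z x u := by
  obtain ⟨w, hw⟩ := h
  obtain ⟨w', hw'⟩ := h'
  refine ⟨w.append w', fun v hv => ?_⟩
  rcases (SimpleGraph.Walk.mem_support_append_iff _ _).1 hv with hv | hv
  exacts [hw v hv, hw' v hv]

theorem left (h : Misses G z x y) : x ≠ z ∧ ¬G.Adj z x :=
  h.choose_spec x (SimpleGraph.Walk.start_mem_support _)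

theorem right (h : Misses G z x y) : y ≠ z ∧ ¬G.Adj z y :=
  h.symm.left

theorem of_adj (h : G.Adj x y) (hx : x ≠ z ∧ ¬G.Adj z x) (hy : y ≠ z ∧ ¬G.Adj z y) :
    Misses G z x y :=
  ⟨h.toWalk, by simp [hx, hy]⟩

/-- A walk that misses `z` either also misses `u`, or can be rerouted to end in `u`. -/
theorem or_of_misses (h : Misses G z x y) (hu : u ≠ z ∧ ¬G.Adj z u) :
    Misses G u x y ∨ Misses G z x u := by
  obtain ⟨w, hw⟩ := h
  by_cases hc : ∀ v ∈ w.support, v ≠ u ∧ ¬G.Adj u v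
  · exact .inl ⟨w, hc⟩
  · right
    push Not at hc
    obtain ⟨v, hv, hvu⟩ := hc
    classical
    have hxv : Misses G z x v :=
      ⟨w.takeUntil v hv, fun a ha => hw a (w.support_takeUntil_subset_support hv ha)⟩
    by_cases huv : v = u
    · exact huv ▸ hxv
    · exact hxv.trans (of_adj (hvu huv).symm (hw v hv) hu)

end Misses

section Admissible

variable {V : Type*} {G : SimpleGraph V}

theorem ATFree.not_misses (hG : ATFree G) {x y z : V} (hz : Misses G z x y)
    (hy : Misses G y x z) (hx : Misses G x y z) : False :=
  hG ⟨x, y, z, hx.left.1.symm, hz.left.1, hz.right.1, hx.left.2, hx.right.2,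
    hy.right.2, hz, hy, hx⟩

open Classical in
/-- In a finite AT-free graph, a vertex `x` maximizing `∑ w, 2 ^ |C w|`, with `C w` the component
of `w` after deletion of the closed neighbourhood of `x`, is admissible. -/
theorem ATFree.exists_admissible [Fintype V] [Nonempty V] (hG : ATFree G) :
    ∃ x : V, Admissible G x := by
  let C : V → V → Finset V := fun x w => {z | Misses G x w z}
  obtain ⟨p, hp⟩ := Finite.exists_max fun x => ∑ w, 2 ^ (C x w).card
  have key : ∀ u v, Misses G u p v → Misses G v p u → ¬ (C p u).card ≤ (C p v).card := by
    intro u v huv hvu hle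
    have hnot : ¬Misses G p u v := fun h => hG.not_misses hvu huv h
    have hup : u ≠ p ∧ ¬G.Adj p u := ⟨huv.left.1.symm, fun h => huv.left.2 h.symm⟩
    have hvp : v ≠ p ∧ ¬G.Adj p v := ⟨hvu.left.1.symm, fun h => hvu.left.2 h.symm⟩
    have hsub : ∀ w, ¬Misses G p u w → C p w ⊆ C u w := by
      intro w hw z hz
      simp only [C, Finset.mem_filter, Finset.mem_univ, true_and] at hz ⊢
      exact (hz.or_of_misses hup).resolve_right fun h => hw h.symm
    have hcongr : ∀ a w, Misses G p a w → C p w = C p a := by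
      intro a w hw
      ext z
      simp only [C, Finset.mem_filter, Finset.mem_univ, true_and]
      exact ⟨hw.trans, hw.symm.trans⟩
    have hpt : ∀ w, 2 ^ (C p w).card + (if w ∈ C p v then 2 ^ (C p v).card else 0)
        + (if w ∈ C p u then 1 else 0)
        ≤ 2 ^ (C u w).card + (if w ∈ C p u then 2 ^ (C p u).card else 0) := by
      intro w
      have hpos : 1 ≤ 2 ^ (C u w).card := Nat.one_le_two_pow
      by_cases hwu : Misses G p u w
      · have hwv : ¬Misses G p v w := fun h => hnot (hwu.trans h.symm)
        have h1 : w ∈ C p u := by simpa [C] using hwu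
        have h2 : w ∉ C p v := by simpa [C] using hwv
        rw [if_pos h1, if_neg h2, if_pos h1, hcongr u w hwu]
        omega
      · have h1 : w ∉ C p u := by simpa [C] using hwu
        rw [if_neg h1, if_neg h1]
        by_cases hwv : Misses G p v w
        · have h2 : w ∈ C p v := by simpa [C] using hwv
          rw [if_pos h2, hcongr v w hwv]
          have hlt : (C p w).card < (C u w).card := by
            refine Finset.card_lt_card ((Finset.ssubset_iff_of_subset (hsub w hwu)).2 ⟨p, ?_, ?_⟩)
            · have : v ∈ C u w := hsub w hwu (by simpa [C] using hwv.symm)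
              simp only [C, Finset.mem_filter, Finset.mem_univ, true_and] at this ⊢
              exact this.trans huv.symm
            · simp only [C, Finset.mem_filter, Finset.mem_univ, true_and]
              exact fun h => h.right.1 rfl
          rw [hcongr v w hwv] at hlt
          have := Nat.pow_le_pow_right (n := 2) (by norm_num) (Nat.succ_le_of_lt hlt)
          rw [pow_succ] at this
          omega
        · have h2 : w ∉ C p v := by simpa [C] using hwv
          rw [if_neg h2]
          exact Nat.pow_le_pow_right (by norm_num) (Finset.card_le_card (hsub w hwu))
    have hsum := Finset.sum_le_sum fun w (_ : w ∈ Finset.univ) => hpt w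
    simp only [Finset.sum_add_distrib, Finset.sum_ite_mem, Finset.univ_inter, Finset.sum_const,
      smul_eq_mul, mul_one] at hsum
    have hmax := hp u
    have hcard : 1 ≤ (C p u).card :=
      Finset.card_pos.2 ⟨u, by simpa [C] using Misses.refl hup.1 hup.2⟩
    have := Nat.mul_le_mul hle (Nat.pow_le_pow_right (n := 2) (by norm_num) hle)
    omega
  refine ⟨p, fun u v huv hvu => ?_⟩
  rcases le_total (C p u).card (C p v).card with h | h
  exacts [key u v huv hvu h, key v u hvu huv h]

theorem Admissible.exists_forall_not_misses [Finite V] {x : V}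
    (hx : Admissible G x) : ∃ y : V, ∀ w, ¬Misses G w x y := by
  let r : V → V → Prop := fun u v => Misses G u x v
  have : IsTrans V r := ⟨fun u v w huv hvw =>
    (hvw.or_of_misses ⟨huv.right.1.symm, fun h => huv.right.2 h.symm⟩).resolve_right
      (hx u v huv)⟩
  have : Std.Irrefl r := ⟨fun u h => h.right.1 rfl⟩
  obtain ⟨y, -, hy⟩ := (Finite.wellFounded_of_trans_of_irrefl r).has_min Set.univ ⟨x, trivial⟩
  exact ⟨y, fun w => hy w trivial⟩

theorem isDominatingPair_of_forall_not_misses {x y : V} (h : ∀ w, ¬Misses G w x y) :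
    IsDominatingPair G x y := by
  intro p _ w
  by_contra! hw
  exact h w ⟨p, fun v hv => ⟨fun e => hw.1 (e ▸ hv), fun e => hw.2 v hv e.symm⟩⟩

/-- If `p` is admissible with neighbourhood `{a, b}`, and `a` is not, then some vertex
outside the closed neighbourhoods of `a` and `b` is reached from `a` by a walk that misses `b`. -/
theorem Admissible.exists_of_not_admissible {p a b : V} (hp : Admissible G p)
    (hN : ∀ w, G.Adj p w ↔ w = a ∨ w = b) (ha : ¬Admissible G a) :
    ∃ u, (u ≠ a ∧ ¬G.Adj a u) ∧ (u ≠ b ∧ ¬G.Adj b u) ∧ Misses G b a u := by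
  simp only [Admissible, not_forall, not_not] at ha
  obtain ⟨u, v, huv, hvu⟩ := ha
  have hpa : G.Adj p a := (hN a).2 (.inl rfl)
  have step : ∀ u v, Misses G u a v → u ≠ b → Misses G u p v := fun u v h hub =>
    .trans (.of_adj hpa
      ⟨fun e => h.left.2 (e ▸ hpa), fun e =>
        ((hN u).1 e.symm).elim (fun e => h.left.1 e.symm) hub⟩ h.left) h
  by_cases hub : u = b
  · subst hub
    exact ⟨v, ⟨hvu.left.1.symm, fun e => hvu.left.2 e.symm⟩, huv.right, huv⟩
  by_cases hvb : v = b
  · subst hvb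
    exact ⟨u, ⟨huv.left.1.symm, fun e => huv.left.2 e.symm⟩, hvu.right, hvu⟩
  exact (hp u v (step u v huv hub) (step v u hvu hvb)).elim

/-- In an AT-free graph, an admissible vertex with neighbourhood `{a, b}` has an admissible
neighbour. -/
theorem Admissible.admissible_or_admissible (hG : ATFree G) {p a b : V} (hp : Admissible G p)
    (hN : ∀ w, G.Adj p w ↔ w = a ∨ w = b) :
    Admissible G a ∨ Admissible G b := by
  by_contra! h
  obtain ⟨u, hua, hub, hu⟩ := hp.exists_of_not_admissible hN h.1
  obtain ⟨v, hvb, hva, hv⟩ := hp.exists_of_not_admissible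
    (fun w => (hN w).trans or_comm) h.2
  have hpa : G.Adj p a := (hN a).2 (.inl rfl)
  have hpb : G.Adj p b := (hN b).2 (.inr rfl)
  have flip : ∀ {c d : V}, (c ≠ d ∧ ¬G.Adj d c) → d ≠ c ∧ ¬G.Adj c d :=
    fun h => ⟨h.1.symm, fun e => h.2 e.symm⟩
  have hpw : ∀ w, (w ≠ a ∧ ¬G.Adj a w) → (w ≠ b ∧ ¬G.Adj b w) → p ≠ w ∧ ¬G.Adj w p :=
    fun w h h' => ⟨fun e => h.2 (e ▸ hpa.symm), fun e => ((hN w).1 e.symm).elim h.1 h'.1⟩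
  have hmid : ∀ w, (w ≠ a ∧ ¬G.Adj a w) → (w ≠ b ∧ ¬G.Adj b w) → Misses G w a b :=
    fun w h h' => .trans (.of_adj hpa.symm (flip h) (hpw w h h'))
      (.of_adj hpb (hpw w h h') (flip h'))
  have huv : Misses G u p v := by
    refine .trans (.of_adj hpb (hpw u hua hub) (flip hub)) ?_
    exact (hv.or_of_misses hua).resolve_right fun h => hG.not_misses (hmid u hua hub) hu h
  have hvu : Misses G v p u := by
    refine .trans (.of_adj hpa (hpw v hva hvb) (flip hva)) ?_
    exact (hu.or_of_misses hvb).resolve_right fun h => hG.not_misses (hmid v hva hvb) h hv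
  exact hp u v huv hvu

/-- If `x` is admissible, no vertex misses a walk from `x` to `p`, and `p` has neighbourhood
`{a, b}`, then `p` can be replaced by `a` or by `b`. -/
theorem Admissible.forall_not_misses_or {x p a b : V} (hx : Admissible G x)
    (hN : ∀ w, G.Adj p w ↔ w = a ∨ w = b) (hp : ∀ w, ¬Misses G w x p) :
    (∀ w, ¬Misses G w x a) ∨ ∀ w, ¬Misses G w x b := by
  have step : ∀ c d w, (∀ w, G.Adj p w ↔ w = c ∨ w = d) → Misses G w x c → w = d := by
    intro c d w hN h
    by_contra hwd
    have hpc : G.Adj p c := (hN c).2 (.inl rfl)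
    exact hp w (h.trans (.of_adj hpc.symm h.right ⟨fun e => h.right.2 (e ▸ hpc),
      fun e => ((hN w).1 e.symm).elim (fun e => h.right.1 e.symm) hwd⟩))
  by_contra! h
  obtain ⟨⟨u, hu⟩, v, hv⟩ := h
  obtain rfl := step a b u hN hu
  obtain rfl := step u a v (fun w => (hN w).trans or_comm) hv
  exact hx u v hu hv

end Admissible

theorem stmt_5 {V : Type*} [Fintype V] (G : SimpleGraph V) (k : ℕ)
    (s t : Fin k → V)
    (hst : ∀ i, s i ≠ t i ∧ ¬ G.Adj (s i) (t i))
    (hdist : ∀ i j : Fin k, i ≠ j →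
      Sym2.mk (s i, t i) ≠ Sym2.mk (s j, t j))
    (hcover : ∀ v : V, ∃ i : Fin k, v = s i ∨ v = t i)
    (H : SimpleGraph (V ⊕ Fin k))
    (hH₁ : ∀ u v : V, H.Adj (Sum.inl u) (Sum.inl v) ↔ G.Adj u v)
    (hH₂ : ∀ (u : V) (i : Fin k), H.Adj (Sum.inl u) (Sum.inr i) ↔ (u = s i ∨ u = t i))
    (hH₃ : ∀ (u : V) (i : Fin k), H.Adj (Sum.inr i) (Sum.inl u) ↔ (u = s i ∨ u = t i))
    (hH₄ : ∀ i j : Fin k, ¬ H.Adj (Sum.inr i) (Sum.inr j))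
    (hAT : ATFree H) (hconn : H.Connected) (hk : 1 ≤ k) :
    ∃ x y : V, IsDominatingPair H (Sum.inl x) (Sum.inl y) := by
  have hN : ∀ i w, H.Adj (Sum.inr i) w ↔ w = Sum.inl (s i) ∨ w = Sum.inl (t i) := by
    rintro i (u | j)
    · simp [hH₃]
    · simp [hH₄]
  have := hconn.nonempty
  obtain ⟨x, hx⟩ : ∃ x : V, Admissible H (Sum.inl x) := by
    obtain ⟨x | i, hp⟩ := hAT.exists_admissible
    · exact ⟨x, hp⟩
    · rcases hp.admissible_or_admissible hAT (hN i) with h | h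
      exacts [⟨_, h⟩, ⟨_, h⟩]
  obtain ⟨y, hy⟩ : ∃ y : V, ∀ w, ¬Misses H w (Sum.inl x) (Sum.inl y) := by
    obtain ⟨y | i, hy⟩ := hx.exists_forall_not_misses
    · exact ⟨y, hy⟩
    · rcases hx.forall_not_misses_or (hN i) hy with h | h
      exacts [⟨_, h⟩, ⟨_, h⟩]
  exact ⟨x, y, isDominatingPair_of_forall_not_misses hy⟩
end

section
/- Let H be a finite connected simple AT-free graph, let (u, v) be a dominating pair of H, and suppose the neighbourhood of u is exactly {s, t} where s and t are distinct non-adjacent vertices, and v ∉ {u, s, t}. Then (s, v) or (t, v) is a dominating pair of H. -/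
theorem IsDominatingPair.exists_walk_support {V : Type*} {G : SimpleGraph V} {x y : V}
    (h : IsDominatingPair G x y) (p : G.Walk x y) (w : V) :
    w ∈ p.support ∨ ∃ z ∈ p.support, G.Adj z w := by
  classical
  rcases h p.bypass p.bypass_isPath w with hw | ⟨z, hz, hzw⟩
  · exact .inl (p.support_bypass_subset_support hw)
  · exact .inr ⟨z, p.support_bypass_subset_support hz, hzw⟩

theorem IsDominatingPair.exists_walk_avoiding {V : Type*} {G : SimpleGraph V} {u v s t : V}
    (h : IsDominatingPair G u v) (hnbr : G.neighborSet u = {s, t})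
    (hs : ¬ IsDominatingPair G s v) :
    ∃ p : G.Walk s v, ∀ x ∈ p.support, x ≠ t ∧ ¬ G.Adj t x := by
  have hmem (x : V) : G.Adj u x ↔ x = s ∨ x = t := by
    rw [← SimpleGraph.mem_neighborSet, hnbr]
    simp
  have hus : G.Adj u s := (hmem s).2 (.inl rfl)
  unfold IsDominatingPair at hs
  push Not at hs
  obtain ⟨p, -, w, hwp, hw⟩ := hs
  suffices hwt : w = t by
    subst hwt
    exact ⟨p, fun x hx => ⟨fun hxw => hwp (hxw ▸ hx), fun hxw => hw x hx hxw.symm⟩⟩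
  have hwu : w ≠ u := by
    rintro rfl
    exact hw s p.start_mem_support hus.symm
  have hws : w ≠ s := by
    rintro rfl
    exact hwp p.start_mem_support
  rcases h.exists_walk_support (.cons hus p) w with hc | ⟨z, hz, hzw⟩
  · simp [hwu, hwp] at hc
  · rw [SimpleGraph.Walk.support_cons, List.mem_cons] at hz
    rcases hz with rfl | hz
    · exact ((hmem w).1 hzw).resolve_left hws
    · exact absurd hzw (hw z hz)

theorem stmt_6 {V : Type*} [Fintype V] (H : SimpleGraph V)
    (hconn : H.Connected) (hAT : ATFree H)
    (u v s t : V)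
    (hdom : IsDominatingPair H u v)
    (hnbr : H.neighborSet u = {s, t})
    (hst : s ≠ t) (hadj : ¬ H.Adj s t)
    (hv : v ≠ u ∧ v ≠ s ∧ v ≠ t) :
    IsDominatingPair H s v ∨ IsDominatingPair H t v := by
  by_contra! hcon
  obtain ⟨p, hp⟩ := hdom.exists_walk_avoiding hnbr hcon.1
  obtain ⟨q, hq⟩ := hdom.exists_walk_avoiding (hnbr.trans (Set.pair_comm s t)) hcon.2
  obtain ⟨hvu, hvs, hvt⟩ := hv
  have hmem (x : V) : H.Adj u x ↔ x = s ∨ x = t := by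
    rw [← SimpleGraph.mem_neighborSet, hnbr]
    simp
  have htv : ¬ H.Adj t v := (hp v p.end_mem_support).2
  have hsv : ¬ H.Adj s v := (hq v q.end_mem_support).2
  have huv : ¬ H.Adj u v := fun h => ((hmem v).1 h).elim hvs hvt
  have hsu : H.Adj s u := ((hmem s).2 (.inl rfl)).symm
  have hut : H.Adj u t := (hmem t).2 (.inr rfl)
  refine hAT ⟨s, t, v, hst, hvs.symm, hvt.symm, hadj, hsv, htv,
    ⟨.cons hsu (.cons hut .nil), ?_⟩, ⟨p, hp⟩, ⟨q, hq⟩⟩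
  simp [hvu.symm, hvs.symm, hvt.symm, H.adj_comm v, hsv, htv, huv]
end

section
/- Assume the terminal-pair setup with auxiliary graph H. Let D be a path in H whose vertex set dominates H and whose two endpoints are terminal vertices (of the form inl x). Then for every i : Fin k, at least one of inl (s i) and inl (t i) lies on D. -/
theorem SimpleGraph.Walk.exists_adj_mem_support {W : Type*} {H : SimpleGraph W} {a b : W}
    (p : H.Walk a b) {w : W} (hw : w ∈ p.support) (hwb : w ≠ b) :
    ∃ u ∈ p.support, H.Adj u w := by
  induction p with
  | nil => exact absurd (by simpa using hw) hwb
  | cons h q ih =>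
    rw [SimpleGraph.Walk.support_cons, List.mem_cons] at hw
    rcases hw with rfl | hw
    · exact ⟨_, List.mem_cons_of_mem _ q.start_mem_support, h.symm⟩
    · obtain ⟨u, hu, huw⟩ := ih hw hwb
      exact ⟨u, List.mem_cons_of_mem _ hu, huw⟩

theorem stmt_7 {V : Type*} [Fintype V] (G : SimpleGraph V) (k : ℕ)
    (s t : Fin k → V)
    (hst : ∀ i, s i ≠ t i ∧ ¬ G.Adj (s i) (t i))
    (hdist : ∀ i j : Fin k, i ≠ j →
      Sym2.mk (s i, t i) ≠ Sym2.mk (s j, t j))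
    (hcover : ∀ v : V, ∃ i : Fin k, v = s i ∨ v = t i)
    (H : SimpleGraph (V ⊕ Fin k))
    (hH₁ : ∀ u v : V, H.Adj (Sum.inl u) (Sum.inl v) ↔ G.Adj u v)
    (hH₂ : ∀ (u : V) (i : Fin k), H.Adj (Sum.inl u) (Sum.inr i) ↔ (u = s i ∨ u = t i))
    (hH₃ : ∀ (u : V) (i : Fin k), H.Adj (Sum.inr i) (Sum.inl u) ↔ (u = s i ∨ u = t i))
    (hH₄ : ∀ i j : Fin k, ¬ H.Adj (Sum.inr i) (Sum.inr j))
    (x y : V) (D : H.Walk (Sum.inl x) (Sum.inl y)) (hD : D.IsPath)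
    (hdom : ∀ w : V ⊕ Fin k, w ∈ D.support ∨ ∃ u ∈ D.support, H.Adj u w) :
    ∀ i : Fin k, Sum.inl (s i) ∈ D.support ∨ Sum.inl (t i) ∈ D.support := by
  intro i
  obtain ⟨u, hu, hadj⟩ : ∃ u ∈ D.support, H.Adj u (Sum.inr i) := by
    rcases hdom (Sum.inr i) with h | h
    · exact D.exists_adj_mem_support h Sum.inr_ne_inl
    · exact h
  cases u with
  | inl v =>
    rcases (hH₂ v i).mp hadj with rfl | rfl
    · exact Or.inl hu
    · exact Or.inr hu
  | inr j => exact absurd hadj (hH₄ j i)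
end

section
/- Let G be a finite simple AT-free graph and let W be a set of vertices such that the subgraph of G induced by W is a tree (connected and acyclic) and W is nonempty. Then this induced tree is a caterpillar: there exist vertices x, y ∈ W and a path from x to y in the induced subgraph on W such that every vertex of W either lies on this path or is adjacent in G to a vertex of this path. -/
namespace SimpleGraph

variable {V : Type*}

/-- In an acyclic graph, the ends of a path of length at least two are not adjacent. -/
theorem IsAcyclic.not_adj_of_isPath {H : SimpleGraph V} (hH : H.IsAcyclic) {u v : V}
    {p : H.Walk u v} (hp : p.IsPath) (hl : 2 ≤ p.length) : ¬H.Adj u v := by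
  intro h
  have := congrArg (fun q : H.Path u v => q.1.length)
    ((hH.subsingleton_path u v).elim ⟨p, hp⟩ (Path.singleton h))
  simp [Path.singleton] at this
  omega

/-- In an acyclic graph, the end of one leg of a spider whose legs have length two is not adjacent
to the vertices outside this leg. -/
theorem IsAcyclic.not_adj_spider_leg {H : SimpleGraph V} (hH : H.IsAcyclic) {a b c b' c' : V}
    (hab : H.Adj a b) (hbc : H.Adj b c) (hab' : H.Adj a b') (hbc' : H.Adj b' c')
    (hd : [a, b, c, b', c'].Nodup) : ¬H.Adj c a ∧ ¬H.Adj c b' ∧ ¬H.Adj c c' := by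
  simp only [List.nodup_cons, List.mem_cons, List.not_mem_nil, or_false, not_or] at hd
  refine ⟨hH.not_adj_of_isPath (p := .cons hbc.symm (.cons hab.symm .nil)) ?_ ?_,
    hH.not_adj_of_isPath (p := .cons hbc.symm (.cons hab.symm (.cons hab' .nil))) ?_ ?_,
    hH.not_adj_of_isPath
      (p := .cons hbc.symm (.cons hab.symm (.cons hab' (.cons hbc' .nil)))) ?_ ?_⟩ <;>
  simp [Walk.cons_isPath_iff] <;> grind

/-- The ends of the legs of a spider with three legs of length two in an acyclic graph form an
asteroidal triple. -/
theorem IsAcyclic.hasAsteroidalTriple_of_spider {H : SimpleGraph V} (hH : H.IsAcyclic)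
    {a b c b₁ c₁ b₂ c₂ : V} (hab : H.Adj a b) (hbc : H.Adj b c)
    (hab₁ : H.Adj a b₁) (hbc₁ : H.Adj b₁ c₁) (hab₂ : H.Adj a b₂) (hbc₂ : H.Adj b₂ c₂)
    (hd : [a, b, c, b₁, c₁, b₂, c₂].Nodup) : HasAsteroidalTriple H := by
  simp only [List.nodup_cons, List.mem_cons, List.not_mem_nil, or_false, not_or] at hd
  have h01 := hH.not_adj_spider_leg hab hbc hab₁ hbc₁ (by simp; grind)
  have h02 := hH.not_adj_spider_leg hab hbc hab₂ hbc₂ (by simp; grind)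
  have h10 := hH.not_adj_spider_leg hab₁ hbc₁ hab hbc (by simp; grind)
  have h12 := hH.not_adj_spider_leg hab₁ hbc₁ hab₂ hbc₂ (by simp; grind)
  have h20 := hH.not_adj_spider_leg hab₂ hbc₂ hab hbc (by simp; grind)
  have h21 := hH.not_adj_spider_leg hab₂ hbc₂ hab₁ hbc₁ (by simp; grind)
  refine ⟨c, c₁, c₂, by grind, by grind, by grind, h01.2.2, h02.2.2, h12.2.2,
    ⟨.cons hbc.symm (.cons hab.symm (.cons hab₁ (.cons hbc₁ .nil))), ?_⟩,
    ⟨.cons hbc.symm (.cons hab.symm (.cons hab₂ (.cons hbc₂ .nil))), ?_⟩,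
    ⟨.cons hbc₁.symm (.cons hab₁.symm (.cons hab₂ (.cons hbc₂ .nil))), ?_⟩⟩ <;>
  simp only [Walk.support_cons, Walk.support_nil, List.mem_cons, List.not_mem_nil, or_false] <;>
  grind

/-- An asteroidal triple of an induced subgraph is one of the whole graph. -/
theorem _root_.HasAsteroidalTriple.of_induce {G : SimpleGraph V} {W : Set V}
    (h : HasAsteroidalTriple (G.induce W)) : HasAsteroidalTriple G := by
  obtain ⟨x, y, z, hxy, hxz, hyz, nxy, nxz, nyz, ⟨p, hp⟩, ⟨q, hq⟩, ⟨r, hr⟩⟩ := h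
  have key {u v t : W} (w : (G.induce W).Walk u v)
      (hw : ∀ s ∈ w.support, s ≠ t ∧ ¬(G.induce W).Adj t s) :
      ∃ w : G.Walk u v, ∀ s ∈ w.support, s ≠ t ∧ ¬G.Adj t s := by
    refine ⟨w.map (Embedding.induce W).toHom, fun s hs => ?_⟩
    obtain ⟨s, hsw, rfl⟩ := List.mem_map.mp (Walk.support_map _ w ▸ hs)
    exact ⟨fun h => (hw s hsw).1 (Subtype.ext h), (hw s hsw).2⟩
  exact ⟨x, y, z, Subtype.coe_injective.ne hxy, Subtype.coe_injective.ne hxz,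
    Subtype.coe_injective.ne hyz, nxy, nxz, nyz, key p hp, key q hq, key r hr⟩

/-- If a longest path in a tree misses the closed neighbourhood of some vertex, then the tree has
an asteroidal triple. -/
theorem IsTree.hasAsteroidalTriple_of_longest_path {H : SimpleGraph V} (hH : H.IsTree) {x y : V}
    {p : H.Walk x y} (hp : p.IsPath)
    (hmax : ∀ (u v : V) (q : H.Walk u v), q.IsPath → q.length ≤ p.length) {w : V}
    (hw : w ∉ p.support) (hw' : ∀ z ∈ p.support, ¬H.Adj z w) : HasAsteroidalTriple H := by
  obtain ⟨r⟩ := hH.connected.preconnected x w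
  obtain ⟨d, -, hb, hc⟩ := r.exists_boundary_dart
    {v | v ∈ p.support ∨ ∃ z ∈ p.support, H.Adj z v} (Or.inl p.start_mem_support)
    (by simpa using ⟨hw, hw'⟩)
  obtain ⟨⟨b, c⟩, hbc⟩ := d
  simp only [Set.mem_ofPred_eq, not_or, not_exists, not_and] at hb hc hbc
  have hbp : b ∉ p.support := fun h => hc.2 b h hbc
  obtain ⟨a, ha, hab⟩ := hb.resolve_left hbp
  obtain ⟨q₁, q₂, rfl⟩ := Walk.mem_support_iff_exists_append.mp ha
  obtain ⟨q₁, rfl⟩ : ∃ q : H.Walk a x, q₁ = q.reverse := ⟨q₁.reverse, by simp⟩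
  have hcp := hc.1
  have hp₁ : q₁.IsPath := by simpa using hp.of_append_left
  have hp₂ : q₂.IsPath := hp.of_append_right
  rw [Walk.mem_support_append_iff, Walk.support_reverse, List.mem_reverse, not_or] at hbp hcp
  have hl₁ := hmax _ _ (.cons hbc.symm (.cons hab.symm q₁))
    (by simp [Walk.cons_isPath_iff, hp₁, hbp, hcp, hbc.ne'])
  have hl₂ := hmax _ _ (.cons hbc.symm (.cons hab.symm q₂))
    (by simp [Walk.cons_isPath_iff, hp₂, hbp, hcp, hbc.ne'])
  simp only [Walk.length_cons, Walk.length_append, Walk.length_reverse] at hl₁ hl₂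
  match q₁, q₂ with
  | .nil, _ => simp at hl₂
  | .cons _ .nil, _ => simp at hl₂; omega
  | _, .nil => simp at hl₁
  | _, .cons _ .nil => simp at hl₁
  | .cons (v := b₁) hab₁ (.cons (v := c₁) hbc₁ s₁),
    .cons (v := b₂) hab₂ (.cons (v := c₂) hbc₂ s₂) =>
    refine hH.isAcyclic.hasAsteroidalTriple_of_spider hab hbc hab₁ hbc₁ hab₂ hbc₂ ?_
    have hs₁ := s₁.start_mem_support
    have hs₂ := s₂.start_mem_support
    have hn := hp.support_nodup
    simp only [Walk.support_append, Walk.support_reverse, Walk.support_cons, List.tail_cons,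
      List.nodup_append, List.nodup_reverse, List.nodup_cons, List.mem_reverse, List.mem_cons]
      at hn hbp hcp
    have := hbc.ne
    simp only [List.nodup_cons, List.mem_cons, List.not_mem_nil, or_false, not_or]
    grind

end SimpleGraph

theorem stmt_13 {V : Type*} [Fintype V] (G : SimpleGraph V) (hAT : ATFree G)
    (W : Set V) (hW : W.Nonempty) (htree : (G.induce W).IsTree) :
    ∃ x y : W, ∃ p : (G.induce W).Walk x y, p.IsPath ∧
      ∀ w : W, w ∈ p.support ∨ ∃ z ∈ p.support, G.Adj (z : V) (w : V) := by
  have := hW.to_subtype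
  obtain ⟨x, y, p, hp, hmax⟩ := SimpleGraph.Walk.exists_isPath_forall_isPath_length_le_length (G.induce W)
  refine ⟨x, y, p, hp, fun w => ?_⟩
  by_contra! h
  exact hAT (htree.hasAsteroidalTriple_of_longest_path hp hmax h.1 h.2).of_induce
end

section
/- Every nonempty finite connected AT-free simple graph G has a dominating pair: there exist vertices x and y such that the vertex set of every path from x to y dominates G. -/
namespace SimpleGraph

variable {V : Type*} {G : SimpleGraph V} {A B : Set V} {a b c u v w x y : V}

/-- The set of vertices outside the closed neighbourhood of `v`. -/
def nonNeighbors (G : SimpleGraph V) (v : V) : Set V := {x | x ≠ v ∧ ¬G.Adj v x}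

lemma mem_nonNeighbors_comm : u ∈ G.nonNeighbors v ↔ v ∈ G.nonNeighbors u := by
  simp only [nonNeighbors, Set.mem_ofPred_eq, G.adj_comm u v, ne_comm]

lemma notMem_nonNeighbors_self : v ∉ G.nonNeighbors v := fun h => h.1 rfl

/-- Two vertices are joined within `A` if some walk between them stays in `A`. -/
def JoinedWithin (G : SimpleGraph V) (A : Set V) (a b : V) : Prop :=
  ∃ p : G.Walk a b, ∀ x ∈ p.support, x ∈ A

namespace JoinedWithin

lemma refl (ha : a ∈ A) : G.JoinedWithin A a a := ⟨.nil, by simpa using ha⟩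

lemma symm (h : G.JoinedWithin A a b) : G.JoinedWithin A b a := by
  obtain ⟨p, hp⟩ := h
  exact ⟨p.reverse, by simpa using hp⟩

lemma left_mem (h : G.JoinedWithin A a b) : a ∈ A := by
  obtain ⟨p, hp⟩ := h
  exact hp _ p.start_mem_support

lemma right_mem (h : G.JoinedWithin A a b) : b ∈ A := h.symm.left_mem

lemma trans (h : G.JoinedWithin A a b) (h' : G.JoinedWithin A b c) : G.JoinedWithin A a c := by
  obtain ⟨p, hp⟩ := h
  obtain ⟨q, hq⟩ := h'
  refine ⟨p.append q, fun x hx => ?_⟩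
  rcases (Walk.mem_support_append_iff p q).1 hx with hx | hx
  · exact hp x hx
  · exact hq x hx

lemma of_adj (h : G.Adj a b) (ha : a ∈ A) (hb : b ∈ A) : G.JoinedWithin A a b :=
  ⟨h.toWalk, by simp [ha, hb]⟩

lemma mono (hAB : A ⊆ B) (h : G.JoinedWithin A a b) : G.JoinedWithin B a b := by
  obtain ⟨p, hp⟩ := h
  exact ⟨p, fun x hx => hAB (hp x hx)⟩

lemma exists_notMem (h : G.JoinedWithin A a b) (hB : ¬G.JoinedWithin B a b) :
    ∃ x, x ∉ B ∧ G.JoinedWithin A a x := by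
  classical
  obtain ⟨p, hp⟩ := h
  by_contra! hx
  refine hB ⟨p, fun x hxp => ?_⟩
  by_contra hxB
  exact hx x hxB
    ⟨p.takeUntil x hxp, fun y hy => hp y (p.support_takeUntil_subset_support hxp hy)⟩

lemma within_component (h : G.JoinedWithin A a b) :
    G.JoinedWithin {x | G.JoinedWithin A a x} a b := by
  by_contra hB
  obtain ⟨x, hx, hax⟩ := h.exists_notMem hB
  exact hx hax

/-- A walk in `A` ending in `B` stays in `B` if `B` absorbs the neighbours in `A` of its
vertices. -/
lemma of_closed (hB : ∀ x ∈ A, ∀ y ∈ B, G.Adj x y → x ∈ B) (h : G.JoinedWithin A a b)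
    (hb : b ∈ B) : G.JoinedWithin (B ∩ A) a b := by
  obtain ⟨p, hp⟩ := h
  induction p with
  | nil => exact refl ⟨hb, by simpa using hp⟩
  | @cons a' b' c' hadj q ih =>
    have hq := ih hb (fun x hx => hp x (by simp [hx]))
    have ha : a' ∈ A := hp _ (by simp)
    have ha' : a' ∈ B ∩ A := ⟨hB _ ha _ hq.left_mem.1 hadj, ha⟩
    exact (of_adj hadj ha' hq.left_mem).trans hq

end JoinedWithin

/-- A vertex `w` is admissible in `A` if no two vertices `u`, `v` are unrelated with respect
to `w`, that is, joined to `w` within `A` by walks avoiding each other's closed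
neighbourhoods. -/
def IsAdmissible (G : SimpleGraph V) (A : Set V) (w : V) : Prop :=
  ∀ u v, G.JoinedWithin (A ∩ G.nonNeighbors v) u w → ¬G.JoinedWithin (A ∩ G.nonNeighbors u) v w

/-- The vertex set of the connected component of `c` in the graph induced on the vertices of `A`
outside the closed neighbourhood of `w`. -/
def missedComponent (G : SimpleGraph V) (A : Set V) (w c : V) : Set V :=
  {x | G.JoinedWithin (A ∩ G.nonNeighbors w) c x}

/-- The vertices of `A` outside `C` with no neighbour in `C` that are adjacent to every vertex
of `A` bordering `C`. -/
def borderComplete (G : SimpleGraph V) (A C : Set V) : Set V :=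
  {r | r ∈ A ∧ r ∉ C ∧ (∀ x ∈ C, ¬G.Adj r x) ∧
    ∀ s ∈ A, s ∉ C → ∀ x ∈ C, G.Adj s x → G.Adj r s}

lemma mem_borderComplete_missedComponent (hw : w ∈ A) :
    w ∈ G.borderComplete A (G.missedComponent A w c) := by
  refine ⟨hw, fun h => notMem_nonNeighbors_self h.right_mem.2, fun x hx => hx.right_mem.2.2,
    fun s hs hsC x hx hsx => ?_⟩
  by_contra hws
  refine hsC (JoinedWithin.trans hx (.of_adj hsx.symm hx.right_mem ⟨hs, ?_, hws⟩))
  rintro rfl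
  exact hx.right_mem.2.2 hsx

lemma mem_borderComplete_of_maximal [Finite V] (hc : c ∈ A ∩ G.nonNeighbors w)
    (hmax : ∀ u ∈ A, ∀ d ∈ A ∩ G.nonNeighbors u,
      (G.missedComponent A u d).ncard ≤ (G.missedComponent A w c).ncard)
    {r : V} (hr : r ∈ G.borderComplete A (G.missedComponent A w c)) (hu : u ∈ A)
    (hur : u ∈ G.nonNeighbors r) (huC : u ∉ G.missedComponent A w c) :
    u ∈ G.borderComplete A (G.missedComponent A w c) := by
  have hnadj : ∀ x ∈ G.missedComponent A w c, ¬G.Adj u x :=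
    fun x hx h => hur.2 (hr.2.2.2 u hu huC x hx h)
  refine ⟨hu, huC, hnadj, fun s hs hsC x hx hsx => ?_⟩
  by_contra hus
  have hsub : G.missedComponent A w c ⊆ A ∩ G.nonNeighbors u := fun y hy =>
    ⟨hy.right_mem.1, by rintro rfl; exact huC hy, hnadj y hy⟩
  have hsub' : G.missedComponent A w c ⊆ G.missedComponent A u c := fun y hy =>
    hy.within_component.mono hsub
  have hsu : s ∈ A ∩ G.nonNeighbors u := ⟨hs, by rintro rfl; exact hnadj x hx hsx, hus⟩
  have hru : r ∈ A ∩ G.nonNeighbors u := ⟨hr.1, mem_nonNeighbors_comm.1 hur⟩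
  have hr' : r ∈ G.missedComponent A u c :=
    ((hsub' hx).trans (.of_adj hsx.symm (hsub hx) hsu)).trans
      (.of_adj (hr.2.2.2 s hs hsC x hx hsx).symm hsu hru)
  have hlt := Set.ncard_lt_ncard (Set.ssubset_iff_of_subset hsub' |>.2 ⟨r, hr', hr.2.1⟩)
    (Set.toFinite _)
  exact absurd (hmax u hu c (hsub (JoinedWithin.refl hc))) (not_le.2 hlt)

end SimpleGraph

open SimpleGraph

lemma ATFree.not_joinedWithin {V : Type*} {G : SimpleGraph V} (hAT : ATFree G) {u v w : V}
    (huw : G.JoinedWithin (G.nonNeighbors v) u w) (hvw : G.JoinedWithin (G.nonNeighbors u) v w) :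
    ¬G.JoinedWithin (G.nonNeighbors w) u v := by
  intro huv
  have h₁ := huw.left_mem
  have h₂ := huw.right_mem
  have h₃ := hvw.right_mem
  exact hAT ⟨u, v, w, h₁.1, h₃.1.symm, h₂.1.symm, fun h => h₁.2 h.symm, h₃.2, h₂.2, huv, huw, hvw⟩

/-- Every nonempty set of vertices of a finite AT-free graph contains a vertex admissible in it. -/
lemma ATFree.exists_isAdmissible {V : Type*} [Finite V] {G : SimpleGraph V} (hAT : ATFree G)
    (A : Set V) (hA : A.Nonempty) : ∃ w ∈ A, G.IsAdmissible A w := by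
  induction hn : A.ncard using Nat.strong_induction_on generalizing A with
  | _ n ih =>
  subst hn
  let T : Set (V × V) := {q | q.1 ∈ A ∧ q.2 ∈ A ∩ G.nonNeighbors q.1}
  rcases T.eq_empty_or_nonempty with hT | hT
  · obtain ⟨w, hw⟩ := hA
    refine ⟨w, hw, fun u v hu hv => ?_⟩
    have : (w, v) ∈ T := ⟨hw, hv.left_mem.1, mem_nonNeighbors_comm.1 hu.right_mem.2⟩
    simp [hT] at this
  · obtain ⟨⟨w, c⟩, ⟨hw, hc⟩, hmax⟩ := Set.exists_max_image T
      (fun q => (G.missedComponent A q.1 q.2).ncard) T.toFinite hT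
    replace hmax : ∀ u ∈ A, ∀ d ∈ A ∩ G.nonNeighbors u,
        (G.missedComponent A u d).ncard ≤ (G.missedComponent A w c).ncard :=
      fun u hu d hd => hmax (u, d) ⟨hu, hd⟩
    have hwR := mem_borderComplete_missedComponent (G := G) (c := c) hw
    have hcl {r u : V} := mem_borderComplete_of_maximal (r := r) (u := u) hc hmax
    have hcC : c ∈ G.missedComponent A w c := JoinedWithin.refl hc
    have hjoin : ∀ u ∈ G.missedComponent A w c, ∀ v ∈ G.missedComponent A w c,
        G.JoinedWithin (G.missedComponent A w c) u v := fun u hu v hv =>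
      (JoinedWithin.within_component hu).symm.trans (JoinedWithin.within_component hv)
    generalize G.missedComponent A w c = C at *
    obtain ⟨z, hz, hadm⟩ := ih _ (Set.ncard_lt_ncard
      (Set.ssubset_iff_of_subset (fun r hr => hr.1) |>.2 ⟨c, hc.1, fun h => h.2.1 hcC⟩)
      A.toFinite) (G.borderComplete A C) ⟨w, hwR⟩ rfl
    have hrestrict : ∀ u v, v ∈ G.borderComplete A C → G.JoinedWithin (A ∩ G.nonNeighbors v) u z →
        G.JoinedWithin (G.borderComplete A C ∩ G.nonNeighbors v) u z := by
      intro u v hv hu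
      refine (hu.of_closed (fun x hx y hy hxy => ?_) hz).mono fun x hx => ⟨hx.1, hx.2.2⟩
      exact hcl hv hx.1 hx.2 fun hxC => hy.2.2.1 x hxC hxy.symm
    refine ⟨z, hz.1, fun u v hu hv => ?_⟩
    have huz := mem_nonNeighbors_comm.1 hv.right_mem.2
    have hvz := mem_nonNeighbors_comm.1 hu.right_mem.2
    by_cases hvC : v ∈ C
    · by_cases huC : u ∈ C
      · exact hAT.not_joinedWithin (hu.mono Set.inter_subset_right)
          (hv.mono Set.inter_subset_right) ((hjoin u huC v hvC).mono fun x hx =>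
            ⟨by rintro rfl; exact hz.2.1 hx, hz.2.2.1 x hx⟩)
      · exact (hrestrict v u (hcl hz hu.left_mem.1 huz huC) hv).left_mem.1.2.1 hvC
    · have hvR := hcl hz hv.left_mem.1 hvz hvC
      have hu' := hrestrict u v hvR hu
      exact hadm u v hu' (hrestrict v u hu'.left_mem.1 hv)

theorem stmt_17 {V : Type*} [Fintype V] [Nonempty V] (G : SimpleGraph V)
    (hconn : G.Connected) (hAT : ATFree G) :
    ∃ x y : V, IsDominatingPair G x y := by
  obtain ⟨w, -, hw⟩ := hAT.exists_isAdmissible Set.univ Set.univ_nonempty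
  simp only [IsAdmissible, Set.univ_inter] at hw
  let D (y : V) : Set V := {u | ¬G.JoinedWithin (G.nonNeighbors u) w y}
  obtain ⟨y, -, hy⟩ := Set.exists_max_image Set.univ (fun y => (D y).ncard) Set.finite_univ
    Set.univ_nonempty
  refine ⟨w, y, fun p _ u => ?_⟩
  by_contra! hu
  have hP : G.JoinedWithin (G.nonNeighbors u) w y :=
    ⟨p, fun x hx => ⟨by rintro rfl; exact hu.1 hx, fun h => hu.2 x hx h.symm⟩⟩
  have hsub : D y ⊆ D u := by
    intro z hz hQ
    obtain ⟨q, hq, hwq⟩ := hQ.exists_notMem (fun h => hw _ _ hP.symm h.symm)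
    have hzu := mem_nonNeighbors_comm.1 hQ.right_mem
    have hzy : z = y ∨ G.Adj y z := by
      by_contra! h
      have hyz : y ∈ G.nonNeighbors z := mem_nonNeighbors_comm.1 h
      refine hz ?_
      by_cases hqy : q = y
      · exact hqy ▸ hwq
      · have hadj : G.Adj y q := by
          by_contra h'
          exact hq ⟨hqy, h'⟩
        exact hwq.trans (.of_adj hadj.symm hwq.right_mem hyz)
    have hwz : G.JoinedWithin (G.nonNeighbors u) w z := by
      rcases hzy with rfl | hzy
      · exact hP
      · exact hP.trans (.of_adj hzy hP.right_mem hzu)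
    exact hw _ _ hwz.symm hQ.symm
  have hlt := Set.ncard_lt_ncard (Set.ssubset_iff_of_subset hsub |>.2
    ⟨u, fun h => notMem_nonNeighbors_self h.right_mem, fun h => h hP⟩) (Set.toFinite _)
  exact absurd (hy u trivial) (not_le.2 hlt)
end
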